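/- Let T₀ ⊆ ℝ² be the reference triangle, the convex hull of (0,0), (1,0), (0,1). Let F = (F₁, F₂) : ℝ² → ℝ² have components that are bivariate polynomial functions of total degree at most 2, suppose F is injective on T₀, and suppose the Jacobian determinant J(ξ,η) = ∂_ξF₁∂_ηF₂ − ∂_ηF₁∂_ξF₂ is strictly positive on T₀. Let k ∈ ℕ and let a quadrature rule on T₀ be given by nodes (ξ_m, η_m) ∈ T₀ and weights ω_m ∈ ℝ, m = 1,…,M, which is exact for all bivariate polynomials g of total degree at most 2k + 2, i.e. ∬_{T₀} g dξdη = Σ_{m=1}^{M} ω_m g(ξ_m, η_m). Then for every bivariate polynomial function f of total degree at most k, the quadrature formula on the curved triangle T := F(T₀) is exact: ∬_{T} f dxdy = Σ_{m=1}^{M} ω_m f(F(ξ_m, η_m)) J(ξ_m, η_m). -/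

import Mathlib

open MeasureTheory MvPolynomial

namespace MvPolynomial

theorem totalDegree_pderiv_le {σ R : Type*} [CommSemiring R] (i : σ) (p : MvPolynomial σ R) :
    (pderiv i p).totalDegree ≤ p.totalDegree - 1 := by
  refine Finset.sup_le fun m hm => ?_
  have hp : m + Finsupp.single i 1 ∈ p.support := by
    rw [mem_support_iff, coeff_pderiv] at hm
    exact mem_support_iff.mpr (left_ne_zero_of_mul hm)
  have hle := le_totalDegree hp
  rw [Finsupp.sum_add_index' (fun _ => rfl) (fun _ _ _ => rfl), Finsupp.sum_single_index rfl] at hle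
  exact Nat.le_sub_of_add_le hle

theorem totalDegree_aeval_le {σ τ R : Type*} [CommSemiring R] {g : σ → MvPolynomial τ R} {d : ℕ}
    (hg : ∀ i, (g i).totalDegree ≤ d) (p : MvPolynomial σ R) :
    (aeval g p).totalDegree ≤ d * p.totalDegree := by
  rw [aeval_def, eval₂_eq]
  refine totalDegree_finsetSum_le fun m hm => ?_
  refine (totalDegree_mul _ _).trans ?_
  rw [algebraMap_eq, totalDegree_C, zero_add]
  calc (∏ i ∈ m.support, g i ^ m i).totalDegree
      ≤ ∑ i ∈ m.support, (g i ^ m i).totalDegree := totalDegree_finsetProd _ _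
    _ ≤ ∑ i ∈ m.support, d * m i := Finset.sum_le_sum fun i _ =>
        (totalDegree_pow _ _).trans (by rw [mul_comm]; exact Nat.mul_le_mul_right _ (hg i))
    _ = d * m.sum fun _ e => e := by rw [Finsupp.sum, Finset.mul_sum]
    _ ≤ d * p.totalDegree := Nat.mul_le_mul_left _ (le_totalDegree hm)

theorem hasFDerivAt_eval {𝕜 E σ : Type*} [NontriviallyNormedField 𝕜] [NormedAddCommGroup E]
    [NormedSpace 𝕜 E] [Fintype σ] {u : E → σ → 𝕜} {u' : σ → E →L[𝕜] 𝕜} {x : E}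
    (hu : ∀ i, HasFDerivAt (fun y => u y i) (u' i) x) (p : MvPolynomial σ 𝕜) :
    HasFDerivAt (fun y => eval (u y) p) (∑ i, eval (u x) (pderiv i p) • u' i) x := by
  classical
  induction p using MvPolynomial.induction_on with
  | C a =>
    simp only [eval_C]
    refine (hasFDerivAt_const a x).congr_fderiv ?_
    ext y
    simp
  | add p q hp hq =>
    simp only [eval_add]
    refine (hp.add hq).congr_fderiv ?_
    ext y
    simp [add_mul, Finset.sum_add_distrib]
  | mul_X p j hp =>
    simp only [eval_mul, eval_X]
    refine (hp.mul (hu j)).congr_fderiv ?_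
    ext y
    simp [Derivation.leibniz, pderiv_X, Pi.single_apply, apply_ite (eval (u x)), add_mul,
      Finset.sum_add_distrib, Finset.mul_sum, mul_assoc]

end MvPolynomial

/-- Exactness of the isoparametric quadrature on a curved triangle: if the
reference quadrature rule on `T₀` is exact for polynomials of total degree at
most `2k + 2`, the map `F` has quadratic polynomial components, is injective
on `T₀` and has positive Jacobian determinant `J` there, then for every
polynomial `f` of total degree at most `k` the quadrature formula on
`T = F(T₀)` is exact. -/
theorem curved_triangle_quadrature_exact
    (T₀ : Set (ℝ × ℝ))
    (hT₀ : T₀ = convexHull ℝ ({((0 : ℝ), (0 : ℝ)), (1, 0), (0, 1)} : Set (ℝ × ℝ)))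
    (F₁ F₂ : MvPolynomial (Fin 2) ℝ)
    (hF₁ : F₁.totalDegree ≤ 2) (hF₂ : F₂.totalDegree ≤ 2)
    (F : (ℝ × ℝ) → (ℝ × ℝ))
    (hF : F = fun p => (eval ![p.1, p.2] F₁, eval ![p.1, p.2] F₂))
    (hFinj : Set.InjOn F T₀)
    (J : (ℝ × ℝ) → ℝ)
    (hJ : J = fun p =>
      eval ![p.1, p.2] (pderiv 0 F₁ * pderiv 1 F₂ - pderiv 1 F₁ * pderiv 0 F₂))
    (hJpos : ∀ p ∈ T₀, 0 < J p)
    (k M : ℕ) (node : Fin M → ℝ × ℝ) (hnode : ∀ m, node m ∈ T₀)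
    (ω : Fin M → ℝ)
    (hexact : ∀ g : MvPolynomial (Fin 2) ℝ, g.totalDegree ≤ 2 * k + 2 →
      ∫ p in T₀, eval ![p.1, p.2] g = ∑ m, ω m * eval ![(node m).1, (node m).2] g)
    (f : MvPolynomial (Fin 2) ℝ) (hf : f.totalDegree ≤ k) :
    ∫ p in F '' T₀, eval ![p.1, p.2] f
      = ∑ m, ω m * eval ![(F (node m)).1, (F (node m)).2] f * J (node m) := by
  have hT₀m : MeasurableSet T₀ := by
    rw [hT₀]
    exact (Set.Finite.isClosed_convexHull ℝ (Set.toFinite _)).measurableSet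
  let F' : ℝ × ℝ → ℝ × ℝ →L[ℝ] ℝ × ℝ := fun p =>
    (Matrix.toLin (.finTwoProd ℝ) (.finTwoProd ℝ)
      !![eval ![p.1, p.2] (pderiv 0 F₁), eval ![p.1, p.2] (pderiv 1 F₁);
        eval ![p.1, p.2] (pderiv 0 F₂), eval ![p.1, p.2] (pderiv 1 F₂)]).toContinuousLinearMap
  have hu : ∀ p : ℝ × ℝ, ∀ i : Fin 2, HasFDerivAt (fun q : ℝ × ℝ => ![q.1, q.2] i)
      (![ContinuousLinearMap.fst ℝ ℝ ℝ, ContinuousLinearMap.snd ℝ ℝ ℝ] i) p := by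
    intro p i
    fin_cases i
    · exact hasFDerivAt_fst
    · exact hasFDerivAt_snd
  have hF' : ∀ p, HasFDerivAt F (F' p) p := by
    intro p
    rw [hF]
    refine ((hasFDerivAt_eval (hu p) F₁).prodMk (hasFDerivAt_eval (hu p) F₂)).congr_fderiv ?_
    simp [F', Matrix.toLin_finTwoProd_toContinuousLinearMap]
  have hdet : ∀ p, (F' p).det = J p := by
    intro p
    simp only [F', hJ, LinearMap.det_toContinuousLinearMap, LinearMap.det_toLin,
      Matrix.det_fin_two_of, map_sub, map_mul]
  let g : MvPolynomial (Fin 2) ℝ :=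
    aeval ![F₁, F₂] f * (pderiv 0 F₁ * pderiv 1 F₂ - pderiv 1 F₁ * pderiv 0 F₂)
  have hg : ∀ p, eval ![p.1, p.2] g = eval ![(F p).1, (F p).2] f * J p := by
    intro p
    have hcomp : eval ![p.1, p.2] (aeval ![F₁, F₂] f) = eval ![(F p).1, (F p).2] f := by
      rw [map_aeval, eval, hF]
      congr 2
      · ext; simp
      · funext i
        fin_cases i <;> rfl
    simp only [g, map_mul (eval ![p.1, p.2]) (aeval ![F₁, F₂] f), hcomp, hJ]
  have hdeg : g.totalDegree ≤ 2 * k + 2 := by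
    have h₁ : ∀ i, (pderiv i F₁).totalDegree ≤ 1 := fun i =>
      (totalDegree_pderiv_le i F₁).trans (by lia)
    have h₂ : ∀ i, (pderiv i F₂).totalDegree ≤ 1 := fun i =>
      (totalDegree_pderiv_le i F₂).trans (by lia)
    refine (totalDegree_mul _ _).trans (add_le_add ?_ ?_)
    · refine (totalDegree_aeval_le (d := 2) (fun i => ?_) f).trans (Nat.mul_le_mul_left 2 hf)
      fin_cases i
      exacts [hF₁, hF₂]
    · exact (totalDegree_sub _ _).trans (max_le
        ((totalDegree_mul _ _).trans (add_le_add (h₁ 0) (h₂ 1)))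
        ((totalDegree_mul _ _).trans (add_le_add (h₁ 1) (h₂ 0))))
  calc ∫ p in F '' T₀, eval ![p.1, p.2] f
      = ∫ p in T₀, |(F' p).det| • eval ![(F p).1, (F p).2] f :=
        integral_image_eq_integral_abs_det_fderiv_smul volume hT₀m
          (fun p _ => (hF' p).hasFDerivWithinAt) hFinj _
    _ = ∫ p in T₀, eval ![p.1, p.2] g := by
        refine setIntegral_congr_fun hT₀m fun p hp => ?_
        simp only [hdet, abs_of_pos (hJpos p hp), hg, smul_eq_mul, mul_comm]
    _ = ∑ m, ω m * eval ![(F (node m)).1, (F (node m)).2] f * J (node m) := by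
        rw [hexact g hdeg]
        simp only [hg, mul_assoc]
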